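/- arXiv:2111.13730 — 7 statements merged into one kernel-verified Lean document; each statement's English description precedes it below -/
import Mathlib

section
/- For every k ≥ 1 and every θ = (θ_0, …, θ_k) ∈ ℝ^{k+1}, the layer unitary satisfies the block recurrence Lay_k(θ) = Matrix.fromBlocks (cos(θ_k/2) • V) ((−i·sin(θ_k/2)) • V) ((−i·sin(θ_k/2)) • (V · X_{k−1})) (cos(θ_k/2) • (V · X_{k−1})), where V := Lay_{k−1}(θ_0, …, θ_{k−1}) and X_{k−1} := X ⊗ₖ I_{2^{k−1}} is the 2^k × 2^k matrix Matrix.fromBlocks 0 I_{2^{k−1}} I_{2^{k−1}} 0. -/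
open Matrix

noncomputable section

/-- The single-qubit rotation gate `RX θ`. -/
def RXg (θ : ℝ) : Matrix (Fin 2) (Fin 2) ℂ :=
  !![(Real.cos (θ / 2) : ℂ), -Complex.I * (Real.sin (θ / 2) : ℂ);
     -Complex.I * (Real.sin (θ / 2) : ℂ), (Real.cos (θ / 2) : ℂ)]

/-- The embedded CX gate `I ⊗ₖ CX ⊗ₖ I` with control qubit `c` and target qubit `t`,
as a matrix on the basis states `Fin n → Fin 2` (qubit `0` being the last Kronecker factor). -/
def CXe {n : ℕ} (c t : Fin n) : Matrix (Fin n → Fin 2) (Fin n → Fin 2) ℂ :=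
  fun u v => if u = Function.update v t (v t + v c) then 1 else 0

/-- The Kronecker product `RX θ_{n-1} ⊗ₖ ⋯ ⊗ₖ RX θ_0`. -/
def RXall {n : ℕ} (θ : Fin n → ℝ) : Matrix (Fin n → Fin 2) (Fin n → Fin 2) ℂ :=
  fun u v => ∏ i, RXg (θ i) (u i) (v i)

/-- The linear entanglement layer `M_1 · M_2 · ⋯ · M_{n-1}`,
where `M_j` is the CX gate with control qubit `j` and target qubit `j-1`. -/
def Elin (n : ℕ) : Matrix (Fin n → Fin 2) (Fin n → Fin 2) ℂ :=
  ((List.finRange (n - 1)).map (fun j =>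
    CXe (n := n) ⟨j.val + 1, by have := j.isLt; omega⟩ ⟨j.val, by have := j.isLt; omega⟩)).prod

/-- The single-layer `n`-qubit RX-CX unitary with linear entanglement. -/
def LayU (n : ℕ) (θ : Fin n → ℝ) : Matrix (Fin n → Fin 2) (Fin n → Fin 2) ℂ :=
  Elin n * RXall θ

/-- Splitting `k+1` qubits according to the value of the top qubit (the first
Kronecker factor, i.e. qubit `k`): `Sum.inl` corresponds to top-qubit value `0`. -/
def splitE (k : ℕ) : ((Fin k → Fin 2) ⊕ (Fin k → Fin 2)) ≃ (Fin (k + 1) → Fin 2) where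
  toFun := Sum.elim (fun u => Fin.snoc u 0) (fun u => Fin.snoc u 1)
  invFun v := if v (Fin.last k) = 0 then Sum.inl (Fin.init v) else Sum.inr (Fin.init v)
  left_inv := by
    rintro (u | u) <;> simp [Fin.snoc_last, Fin.init_snoc]
  right_inv := by
    intro v
    dsimp only
    by_cases h : v (Fin.last k) = 0
    · rw [if_pos h]
      exact h ▸ Fin.snoc_init_self v
    · rw [if_neg h]
      have h1 : v (Fin.last k) = 1 := by
        have h2 := (v (Fin.last k)).isLt
        have h3 : (v (Fin.last k)).val ≠ 0 := fun hc => h (Fin.ext hc)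
        apply Fin.ext
        omega
      exact h1 ▸ Fin.snoc_init_self v

/-- `X_k := X ⊗ₖ I_{2^k} = Matrix.fromBlocks 0 I I 0`, the bit flip on the top qubit of `k+1` qubits. -/
def XtopM (k : ℕ) : Matrix (Fin (k + 1) → Fin 2) (Fin (k + 1) → Fin 2) ℂ :=
  Matrix.reindex (splitE k) (splitE k)
    (Matrix.fromBlocks 0 (1 : Matrix (Fin k → Fin 2) (Fin k → Fin 2) ℂ) 1 0)

/-- The matrix `I_2 ⊗ₖ A`, acting trivially on an additional top qubit. -/
def idTop (k : ℕ) :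
    Matrix (Fin k → Fin 2) (Fin k → Fin 2) ℂ →*
      Matrix (Fin (k + 1) → Fin 2) (Fin (k + 1) → Fin 2) ℂ where
  toFun A := reindex (splitE k) (splitE k) (fromBlocks A 0 0 A)
  map_one' := by simp
  map_mul' A B := by simp [fromBlocks_multiply, submatrix_mul_equiv]

theorem eq_reindex_splitE {k : ℕ} {A : Matrix (Fin (k + 1) → Fin 2) (Fin (k + 1) → Fin 2) ℂ}
    {a b c d : Matrix (Fin k → Fin 2) (Fin k → Fin 2) ℂ}
    (ha : ∀ u v, A (Fin.snoc u 0) (Fin.snoc v 0) = a u v)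
    (hb : ∀ u v, A (Fin.snoc u 0) (Fin.snoc v 1) = b u v)
    (hc : ∀ u v, A (Fin.snoc u 1) (Fin.snoc v 0) = c u v)
    (hd : ∀ u v, A (Fin.snoc u 1) (Fin.snoc v 1) = d u v) :
    A = reindex (splitE k) (splitE k) (fromBlocks a b c d) := by
  rw [← Equiv.symm_apply_eq]
  ext (u | u) (v | v)
  exacts [ha u v, hb u v, hc u v, hd u v]

theorem snoc_eq_snoc_iff {k : ℕ} (u v : Fin k → Fin 2) (a b : Fin 2) :
    (Fin.snoc u a : Fin (k + 1) → Fin 2) = Fin.snoc v b ↔ u = v ∧ a = b :=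
  Fin.snoc_inj

theorem CXe_castSucc {n : ℕ} (c t : Fin n) :
    CXe c.castSucc t.castSucc = idTop n (CXe c t) := by
  refine eq_reindex_splitE ?_ ?_ ?_ ?_ <;> intro u v <;>
    simp only [CXe, Fin.snoc_castSucc, ← Fin.snoc_update, snoc_eq_snoc_iff] <;> simp

theorem XtopM_eq (k : ℕ) :
    XtopM k = fun u v => if u = Function.update v (Fin.last k) (v (Fin.last k) + 1)
      then 1 else 0 := by
  symm
  refine eq_reindex_splitE ?_ ?_ ?_ ?_ <;> intro u v <;>
    simp only [Fin.snoc_last, Fin.update_snoc_last, snoc_eq_snoc_iff] <;>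
    simp [Matrix.one_apply]

theorem CXe_last (k : ℕ) :
    CXe (Fin.last (k + 1)) (Fin.last k).castSucc =
      reindex (splitE (k + 1)) (splitE (k + 1)) (fromBlocks 1 0 0 (XtopM k)) := by
  rw [XtopM_eq]
  refine eq_reindex_splitE ?_ ?_ ?_ ?_ <;> intro u v <;>
    simp only [CXe, Fin.snoc_castSucc, Fin.snoc_last, ← Fin.snoc_update, snoc_eq_snoc_iff] <;>
    simp [Matrix.one_apply]

theorem Elin_succ (k : ℕ) :
    Elin (k + 2) = idTop (k + 1) (Elin (k + 1)) *
      reindex (splitE (k + 1)) (splitE (k + 1)) (fromBlocks 1 0 0 (XtopM k)) := by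
  rw [← CXe_last, Elin, Elin, map_list_prod]
  simp only [Nat.add_one_sub_one, List.finRange_succ_last, List.map_append,
    List.map_map, List.prod_append, List.map_cons, List.map_nil, List.prod_singleton]
  congr 3
  funext j
  have hj : j.val < k := j.isLt
  exact CXe_castSucc (n := k + 1) ⟨j.val + 1, by omega⟩ ⟨j.val, by omega⟩

theorem RXall_succ {k : ℕ} (θ : Fin (k + 1) → ℝ) :
    RXall θ = reindex (splitE k) (splitE k)
      (fromBlocks
        ((Real.cos (θ (Fin.last k) / 2) : ℂ) • RXall (fun i => θ i.castSucc))
        ((-Complex.I * (Real.sin (θ (Fin.last k) / 2) : ℂ)) • RXall (fun i => θ i.castSucc))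
        ((-Complex.I * (Real.sin (θ (Fin.last k) / 2) : ℂ)) • RXall (fun i => θ i.castSucc))
        ((Real.cos (θ (Fin.last k) / 2) : ℂ) • RXall (fun i => θ i.castSucc))) := by
  refine eq_reindex_splitE ?_ ?_ ?_ ?_ <;> intro u v <;>
    simp [RXall, Fin.prod_univ_castSucc, RXg, mul_comm]

theorem XtopM_commute_RXall {k : ℕ} (θ : Fin (k + 1) → ℝ) : Commute (XtopM k) (RXall θ) := by
  rw [commute_iff_eq, RXall_succ, XtopM]
  simp only [reindex_apply, submatrix_mul_equiv, fromBlocks_multiply]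
  simp

theorem stmt2 (k : ℕ) (θ : Fin (k + 2) → ℝ) :
    LayU (k + 2) θ =
      Matrix.reindex (splitE (k + 1)) (splitE (k + 1))
        (Matrix.fromBlocks
          ((Real.cos (θ (Fin.last (k + 1)) / 2) : ℂ) • LayU (k + 1) (fun i => θ i.castSucc))
          ((-Complex.I * (Real.sin (θ (Fin.last (k + 1)) / 2) : ℂ)) •
            LayU (k + 1) (fun i => θ i.castSucc))
          ((-Complex.I * (Real.sin (θ (Fin.last (k + 1)) / 2) : ℂ)) •
            (LayU (k + 1) (fun i => θ i.castSucc) * XtopM k))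
          ((Real.cos (θ (Fin.last (k + 1)) / 2) : ℂ) •
            (LayU (k + 1) (fun i => θ i.castSucc) * XtopM k))) := by
  rw [LayU, Elin_succ, RXall_succ]
  simp only [LayU, idTop, MonoidHom.coe_mk, OneHom.coe_mk, reindex_apply, submatrix_mul_equiv,
    fromBlocks_multiply, Matrix.mul_assoc, ← (XtopM_commute_RXall _).eq]
  simp [Matrix.mul_assoc]
end
end

section
/- Fix k ≥ 0 and set l := 2^{⌈log₂(k+2)⌉}, and let X_k := X ⊗ₖ I_{2^k}. For arbitrary parameter vectors θ^{(0)}, …, θ^{(l−1)} ∈ ℝ^{k+1} and every b ∈ {0,1}^l, define G(b) := (Lay_k(θ^{(l−1)}) · X_k^{b_{l−1}}) · (Lay_k(θ^{(l−2)}) · X_k^{b_{l−2}}) · ⋯ · (Lay_k(θ^{(0)}) · X_k^{b_0}). Then G(b) = G(b̄), where b̄ is the bitwise complement of b (b̄_j = 1 − b_j for all j). -/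
open Matrix

noncomputable section

/-- `G(b) = (Lay_k(θ^{(l-1)}) · X_k^{b_{l-1}}) · ⋯ · (Lay_k(θ^{(0)}) · X_k^{b_0})`. -/
def Gfun (k : ℕ) {l : ℕ} (θ : Fin l → (Fin (k + 1) → ℝ)) (b : Fin l → Bool) :
    Matrix (Fin (k + 1) → Fin 2) (Fin (k + 1) → Fin 2) ℂ :=
  ((List.finRange l).reverse.map (fun j => LayU (k + 1) (θ j) * (XtopM k) ^ (b j).toNat)).prod

section CharacteristicTwo

variable {R : Type*} [Ring R]

theorem one_add_pow_two_pow (h : (2 : R) = 0) (N : R) (t : ℕ) :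
    (1 + N) ^ 2 ^ t = 1 + N ^ 2 ^ t := by
  induction t with
  | zero => simp
  | succ t ih =>
    rw [pow_succ, pow_mul, ih, pow_mul, pow_two, pow_two, mul_add, mul_one, add_mul, one_mul,
      add_assoc, ← add_assoc (N ^ 2 ^ t), ← two_mul (N ^ 2 ^ t), h, zero_mul, zero_add]

/-- In characteristic two, `∑_{j < 2^t} (1 + N)^j = N^(2^t - 1)`. -/
theorem sum_one_add_pow_range_two_pow (h : (2 : R) = 0) (N : R) (t : ℕ) :
    ∑ j ∈ Finset.range (2 ^ t), (1 + N) ^ j = N ^ (2 ^ t - 1) := by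
  induction t with
  | zero => simp
  | succ t ih =>
    have hpos : 0 < 2 ^ t := by positivity
    have hexp : 2 ^ (t + 1) - 1 = 2 ^ t + (2 ^ t - 1) := by omega
    rw [hexp, pow_succ, mul_two, Finset.sum_range_add]
    simp only [pow_add]
    rw [← Finset.mul_sum, ih, one_add_pow_two_pow h, add_mul, one_mul, ← add_assoc,
      ← two_mul, h, zero_mul, zero_add]

end CharacteristicTwo

/-- The shift `(N v)_j = v_{j+1}`, with value `0` in the top position. -/
def shiftEnd (n : ℕ) : AddMonoid.End (Fin n → Fin 2) where
  toFun v j := if h : j.val + 1 < n then v ⟨j.val + 1, h⟩ else 0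
  map_zero' := by
    funext j
    simp
  map_add' v w := by
    funext j
    by_cases h : j.val + 1 < n <;> simp [h]

theorem shiftEnd_apply {n : ℕ} (v : Fin n → Fin 2) (j : Fin n) :
    shiftEnd n v j = if h : j.val + 1 < n then v ⟨j.val + 1, h⟩ else 0 := rfl

theorem shiftEnd_pow_apply {n : ℕ} (m : ℕ) (v : Fin n → Fin 2) (j : Fin n) :
    (shiftEnd n ^ m) v j = if h : j.val + m < n then v ⟨j.val + m, h⟩ else 0 := by
  induction m generalizing j with
  | zero => simp
  | succ m ih =>
    rw [pow_succ', AddMonoid.End.coe_mul, Function.comp_apply, shiftEnd_apply]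
    by_cases h : j.val + 1 < n
    · rw [dif_pos h, ih]
      have e : j.val + 1 + m = j.val + (m + 1) := by ring
      simp only [e]
    · rw [dif_neg h, dif_neg (by omega)]

theorem shiftEnd_pow_eq_zero {n m : ℕ} (h : n ≤ m) : shiftEnd n ^ m = 0 := by
  ext v j
  rw [shiftEnd_pow_apply, dif_neg (by omega)]
  rfl

theorem add_self_bits {n : ℕ} (v : Fin n → Fin 2) : v + v = 0 := by
  funext i
  have : ∀ a : Fin 2, a + a = 0 := by decide
  exact this (v i)

theorem add_add_cancel_bits {n : ℕ} (v w : Fin n → Fin 2) : v + w + w = v := by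
  rw [add_assoc, add_self_bits, add_zero]

theorem two_eq_zero_end (n : ℕ) : (2 : AddMonoid.End (Fin n → Fin 2)) = 0 := by
  refine one_add_one_eq_two.symm.trans (AddMonoidHom.ext fun v => ?_)
  exact add_self_bits v

/-- The `0/1` matrix sending the basis state `v` to `f v`. -/
def basisMap {V : Type*} [DecidableEq V] (f : V → V) : Matrix V V ℂ :=
  fun u v => if u = f v then 1 else 0

theorem basisMap_mul {V : Type*} [DecidableEq V] [Fintype V] (f g : V → V) :
    basisMap f * basisMap g = basisMap (f ∘ g) := by
  ext u v
  simp [basisMap, Matrix.mul_apply]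

/-- The product of the bit flips `X` on the qubits in the support of `w`. -/
def flipM {n : ℕ} (w : Fin n → Fin 2) : Matrix (Fin n → Fin 2) (Fin n → Fin 2) ℂ :=
  basisMap (· + w)

theorem flipM_zero {n : ℕ} : flipM (0 : Fin n → Fin 2) = 1 := by
  ext u v
  simp [flipM, basisMap, Matrix.one_apply]

theorem flipM_mul {n : ℕ} (w w' : Fin n → Fin 2) : flipM w * flipM w' = flipM (w + w') := by
  rw [flipM, flipM, basisMap_mul, flipM]
  congr 1
  funext v
  simp only [Function.comp_apply, add_assoc, add_comm w]

theorem flipM_mul_CXe {n : ℕ} {c t : Fin n} (h : c ≠ t) (w : Fin n → Fin 2) :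
    flipM w * CXe c t = CXe c t * flipM (Function.update w t (w t + w c)) := by
  have hCX : CXe c t = basisMap fun v => Function.update v t (v t + v c) := rfl
  rw [hCX, flipM, flipM, basisMap_mul, basisMap_mul]
  congr 1
  funext v i
  have key : ∀ a b x y : Fin 2, a + b + x = a + (x + y) + (b + y) := by decide
  by_cases hi : i = t
  · subst hi
    simp only [Function.comp_apply, Function.update_self, Pi.add_apply, Function.update_of_ne h]
    exact key _ _ _ _
  · simp [hi]

theorem RXg_add_left (θ : ℝ) (a b x : Fin 2) : RXg θ (a + x) b = RXg θ a (b + x) := by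
  fin_cases a <;> fin_cases b <;> fin_cases x <;> simp [RXg]

theorem flipM_mul_RXall {n : ℕ} (θ : Fin n → ℝ) (w : Fin n → Fin 2) :
    flipM w * RXall θ = RXall θ * flipM w := by
  ext u v
  have hu : ∀ x, u = x + w ↔ u + w = x := fun x =>
    ⟨fun h => by rw [h, add_add_cancel_bits], fun h => by rw [← h, add_add_cancel_bits]⟩
  simp [Matrix.mul_apply, flipM, basisMap, hu, RXall, RXg_add_left]

/-- Conjugation of bit flips by the first `m` gates of the linear entanglement layer. -/
theorem flipM_mul_prod_CXe {n : ℕ} (m : ℕ) (hm : m ≤ n - 1) (w : Fin n → Fin 2) :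
    flipM w * ((List.finRange m).map (fun j =>
      CXe (n := n) ⟨j.val + 1, by have := j.isLt; omega⟩ ⟨j.val, by have := j.isLt; omega⟩)).prod =
    ((List.finRange m).map (fun j =>
      CXe (n := n) ⟨j.val + 1, by have := j.isLt; omega⟩ ⟨j.val, by have := j.isLt; omega⟩)).prod *
      flipM (fun j => if j.val < m then w j + shiftEnd n w j else w j) := by
  induction m with
  | zero => simp
  | succ m ih =>
    rw [List.finRange_succ_last, List.map_append, List.prod_append, List.map_map, ← mul_assoc]
    have ih' := ih (by omega)
    simp only [Function.comp_def, Fin.val_castSucc, List.map_cons, List.map_nil,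
      List.prod_singleton, Fin.val_last] at ih' ⊢
    rw [ih', mul_assoc, flipM_mul_CXe (by simp), ← mul_assoc]
    congr 2
    funext j
    by_cases hj : j.val = m
    · subst hj
      have hm' : j.val + 1 < n := by omega
      simp [shiftEnd_apply, hm']
    · have hj' : j ≠ ⟨m, by omega⟩ := fun h => hj (congrArg Fin.val h)
      rw [Function.update_of_ne hj']
      have : j.val < m + 1 ↔ j.val < m := by omega
      simp only [this]

theorem flipM_mul_Elin {n : ℕ} (w : Fin n → Fin 2) :
    flipM w * Elin n = Elin n * flipM ((1 + shiftEnd n) w) := by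
  rw [Elin, flipM_mul_prod_CXe (n - 1) le_rfl]
  congr 2
  funext j
  have happ : (1 + shiftEnd n) w j = w j + shiftEnd n w j := rfl
  rw [happ]
  split_ifs with h
  · rfl
  · rw [shiftEnd_apply, dif_neg (by omega), add_zero]

theorem flipM_mul_LayU {n : ℕ} (θ : Fin n → ℝ) (w : Fin n → Fin 2) :
    flipM w * LayU n θ = LayU n θ * flipM ((1 + shiftEnd n) w) := by
  rw [LayU, ← mul_assoc, flipM_mul_Elin, mul_assoc, flipM_mul_RXall, mul_assoc]

theorem XtopM_eq_flipM (k : ℕ) : XtopM k = flipM (Pi.single (Fin.last k) 1) := by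
  have h0 : ∀ a : Fin k → Fin 2, (Fin.snoc a 0 : Fin (k + 1) → Fin 2) + Pi.single (Fin.last k) 1 =
      Fin.snoc a 1 := by
    intro a
    funext i
    refine Fin.lastCases ?_ (fun i => ?_) i <;> simp
  have h1 : ∀ a : Fin k → Fin 2, (Fin.snoc a 1 : Fin (k + 1) → Fin 2) + Pi.single (Fin.last k) 1 =
      Fin.snoc a 0 := by
    intro a
    rw [← h0, add_add_cancel_bits]
  ext u v
  obtain ⟨u, rfl⟩ := (splitE k).surjective u
  obtain ⟨v, rfl⟩ := (splitE k).surjective v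
  rcases u with u | u <;> rcases v with v | v <;>
    simp [XtopM, flipM, basisMap, Matrix.one_apply, splitE, h0, h1, Fin.snoc_inj]

theorem XtopM_pow_toNat (k : ℕ) (b : Bool) :
    XtopM k ^ b.toNat = flipM (if b then Pi.single (Fin.last k) 1 else 0) := by
  cases b <;> simp [XtopM_eq_flipM, flipM_zero]

/-- All bit flips in `G(b)` can be moved to the right. -/
theorem Gfun_eq_mul_flipM (k : ℕ) {l : ℕ} (θ : Fin l → (Fin (k + 1) → ℝ)) (b : Fin l → Bool) :
    Gfun k θ b = Gfun k θ (fun _ => false) * flipM (∑ j : Fin l,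
      ((1 + shiftEnd (k + 1)) ^ j.val) (if b j then Pi.single (Fin.last k) 1 else 0)) := by
  have hsucc : ∀ {l : ℕ} (θ : Fin (l + 1) → (Fin (k + 1) → ℝ)) (b : Fin (l + 1) → Bool),
      Gfun k θ b = Gfun k (fun j => θ j.succ) (fun j => b j.succ) *
        (LayU (k + 1) (θ 0) * XtopM k ^ (b 0).toNat) := by
    intro l θ b
    simp [Gfun, List.finRange_succ, ← List.map_reverse, Function.comp_def]
  induction l with
  | zero => simp [Gfun, flipM_zero]
  | succ l ih =>
    rw [hsucc, ih, hsucc θ fun _ => false, XtopM_pow_toNat, mul_assoc, ← mul_assoc (flipM _),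
      flipM_mul_LayU, mul_assoc (LayU _ _), flipM_mul, ← mul_assoc, Fin.sum_univ_succ, map_sum]
    simp only [Bool.toNat_false, pow_zero, mul_one, Fin.val_zero, Fin.val_succ, pow_succ',
      AddMonoid.End.coe_mul, Function.comp_apply, AddMonoid.End.coe_one, id_eq]
    rw [add_comm (∑ _, _)]

theorem stmt3 (k : ℕ)
    (θ : Fin (2 ^ Nat.clog 2 (k + 2)) → (Fin (k + 1) → ℝ))
    (b : Fin (2 ^ Nat.clog 2 (k + 2)) → Bool) :
    Gfun k θ b = Gfun k θ (fun j => ! b j) := by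
  rw [Gfun_eq_mul_flipM, Gfun_eq_mul_flipM k θ fun j => ! b j]
  congr 2
  have hl : k + 1 ≤ 2 ^ Nat.clog 2 (k + 2) - 1 := by
    have := Nat.le_pow_clog one_lt_two (k + 2)
    omega
  have hsum : ∑ j : Fin (2 ^ Nat.clog 2 (k + 2)), (1 + shiftEnd (k + 1)) ^ j.val = 0 := by
    rw [Fin.sum_univ_eq_sum_range (fun j => (1 + shiftEnd (k + 1)) ^ j),
      sum_one_add_pow_range_two_pow (two_eq_zero_end _), shiftEnd_pow_eq_zero hl]
  rw [← add_right_cancel_iff (a := ∑ j : Fin (2 ^ Nat.clog 2 (k + 2)),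
      ((1 + shiftEnd (k + 1)) ^ j.val) (if (! b j) then Pi.single (Fin.last k) 1 else 0)),
    add_self_bits, ← Finset.sum_add_distrib]
  have happ := DFunLike.congr_fun hsum (Pi.single (Fin.last k) 1)
  refine Eq.trans (Finset.sum_congr rfl fun j _ => ?_)
    ((AddMonoidHom.finsetSum_apply _ _ _).symm.trans happ)
  cases b j <;> simp <;> rfl
end
end

section
/- Let r ≥ 1 and l = 2^{r+1}, and let a : Fin l → Bool be the alternating vector with a(i) = true if and only if i is even. Then the (2^r − 2)-fold iterate of the prefix-XOR map p applied to a is the indicator vector of {0, 2^r} (true exactly at indices 0 and 2^r), and the (2^{r+1} − 2)-fold iterate of p applied to a is the indicator vector of {0} (true exactly at index 0). -/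
/-- The prefix-XOR map: `p(b)(i) = true` iff the number of indices `j ≤ i` with
`b j = true` is odd. -/
def pXor {N : ℕ} (b : Fin N → Bool) : Fin N → Bool :=
  fun i => decide (Odd (Finset.univ.filter (fun j => j ≤ i ∧ b j = true)).card)

open PowerSeries in
theorem coeff_mk_one_pow_two_pow (m n : ℕ) :
    coeff n ((mk 1 : (ZMod 2)⟦X⟧) ^ 2 ^ m) = if 2 ^ m ∣ n then 1 else 0 := by
  have hinv : (mk 1 : (ZMod 2)⟦X⟧) ^ 2 ^ m * (1 - X ^ 2 ^ m) = 1 := by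
    have : CharP (ZMod 2)⟦X⟧ 2 := charP_of_injective_ringHom (C_injective (R := ZMod 2)) 2
    have hfrob : (1 - X ^ 2 ^ m : (ZMod 2)⟦X⟧) = (1 - X) ^ 2 ^ m := by
      rw [sub_pow_char_pow, one_pow]
    rw [hfrob, ← mul_pow, mk_one_mul_one_sub_eq_one, one_pow]
  have hrec (k : ℕ) := congrArg (coeff k) hinv
  simp only [mul_sub, mul_one, map_sub, coeff_mul_X_pow', coeff_one] at hrec
  have hpos : 0 < 2 ^ m := by positivity
  induction n using Nat.strong_induction_on with
  | _ n ih =>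
    rcases Nat.lt_or_ge n (2 ^ m) with hlt | hge
    · have h := hrec n
      rw [if_neg (not_le.2 hlt), sub_zero] at h
      have hiff : 2 ^ m ∣ n ↔ n = 0 :=
        ⟨fun hd => Nat.eq_zero_of_dvd_of_lt hd hlt, fun h0 => h0 ▸ dvd_zero _⟩
      simp only [h, hiff]
    · obtain ⟨k, rfl⟩ := Nat.exists_eq_add_of_le' hge
      have h := hrec (k + 2 ^ m)
      rw [if_pos hge, if_neg (by omega), sub_eq_zero, Nat.add_sub_cancel, ih k (by omega)] at h
      simp only [h, Nat.dvd_add_self_right]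

open PowerSeries in
/-- The prefix-XOR map multiplies the generating function over `ZMod 2` by `1 / (1 - X)`. -/
theorem pXor_coeff {N : ℕ} (φ : (ZMod 2)⟦X⟧) :
    pXor (fun i : Fin N => decide (coeff i.val φ = 1))
      = fun i => decide (coeff i.val (φ * mk 1) = 1) := by
  funext i
  have hsum : coeff i.val (φ * mk 1) = ∑ j ∈ Finset.univ.filter (· ≤ i), coeff j.val φ := by
    rw [coeff_mul, Finset.Nat.sum_antidiagonal_eq_sum_range_succ_mk]
    simp only [coeff_mk, Pi.one_apply, mul_one]
    symm
    refine Finset.sum_bij (fun j _ => j.val) ?_ (fun _ _ _ _ h => Fin.ext h) ?_ (fun _ _ => rfl)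
    · intro j hj
      simpa [Nat.lt_succ_iff] using hj
    · intro k hk
      have hk' : k < i.val + 1 := by simpa using hk
      exact ⟨⟨k, by omega⟩, Finset.mem_filter.2 ⟨Finset.mem_univ _, Fin.mk_le_of_le_val (by omega)⟩, rfl⟩
  have hbit (x : ZMod 2) : x = if x = 1 then 1 else 0 := by
    revert x; decide
  have hcard : ((Finset.univ.filter fun j : Fin N => j ≤ i ∧ coeff j.val φ = 1).card : ZMod 2)
      = coeff i.val (φ * mk 1) := by
    rw [hsum, ← Finset.filter_filter, Finset.card_filter, Nat.cast_sum]
    refine Finset.sum_congr rfl fun j _ => ?_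
    rw [Nat.cast_ite, Nat.cast_one, Nat.cast_zero, ← hbit]
  simp only [pXor, decide_eq_true_eq, ← hcard, ZMod.natCast_eq_one_iff_odd]

open PowerSeries in
theorem iterate_pXor_coeff {N : ℕ} (φ : (ZMod 2)⟦X⟧) (k : ℕ) :
    pXor^[k] (fun i : Fin N => decide (coeff i.val φ = 1))
      = fun i => decide (coeff i.val (φ * mk 1 ^ k) = 1) := by
  induction k with
  | zero => simp
  | succ k ih => rw [Function.iterate_succ_apply', ih, pXor_coeff, pow_succ, mul_assoc]

theorem iterate_pXor_alternating {N m : ℕ} (hm : 1 ≤ m) :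
    pXor^[2 ^ m - 2] (fun i : Fin N => decide (Even i.val))
      = fun i => decide (2 ^ m ∣ i.val) := by
  have hpow : 2 + (2 ^ m - 2) = 2 ^ m := by
    have := Nat.pow_le_pow_right (n := 2) (by norm_num) hm
    omega
  have h := iterate_pXor_coeff (N := N) (PowerSeries.mk 1 ^ 2 ^ 1) (2 ^ m - 2)
  rw [pow_one, ← pow_add, hpow] at h
  have hsq (n : ℕ) := coeff_mk_one_pow_two_pow 1 n
  rw [pow_one] at hsq
  simpa [hsq, coeff_mk_one_pow_two_pow, ← even_iff_two_dvd] using h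

theorem stmt5 (r : ℕ) (hr : 1 ≤ r) :
    ((pXor (N := 2 ^ (r + 1)))^[2 ^ r - 2]
        (fun i : Fin (2 ^ (r + 1)) => decide (Even i.val))
      = fun i => decide (i.val = 0 ∨ i.val = 2 ^ r)) ∧
    ((pXor (N := 2 ^ (r + 1)))^[2 ^ (r + 1) - 2]
        (fun i : Fin (2 ^ (r + 1)) => decide (Even i.val))
      = fun i => decide (i.val = 0)) := by
  rw [iterate_pXor_alternating hr, iterate_pXor_alternating (Nat.le_add_left 1 r)]
  refine ⟨funext fun i => decide_eq_decide.2 ⟨?_, ?_⟩, funext fun i => decide_eq_decide.2 ⟨?_, ?_⟩⟩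
  · rintro ⟨c, hc⟩
    have hlt : 2 ^ r * c < 2 ^ r * 2 := by
      rw [← hc, ← pow_succ]
      exact i.isLt
    have hc2 : c < 2 := lt_of_mul_lt_mul_left' hlt
    interval_cases c <;> simp [hc]
  · rintro (h | h) <;> simp [h]
  · exact fun hd => Nat.eq_zero_of_dvd_of_lt hd i.isLt
  · intro h
    simp [h]
end

section
/- Let n ≥ 1, L ≥ 1, and Θ = (Θ_0, …, Θ_{L−1}) ∈ (ℝ^n)^L, and let U(Θ) := Lay_{n−1}(Θ_{L−1}) · ⋯ · Lay_{n−1}(Θ_0) be the n-qubit L-layer RX-CX ansatz with linear entanglement. Fix a qubit index 0 ≤ i ≤ n−1 and set m_i := 2^{⌈log₂(i+1)⌉}. If j ≥ 0 and j + m_i ≤ L − 1, then for every δ ∈ ℝ, U(Θ') = U(Θ), where Θ' agrees with Θ in all entries except Θ'_{j,i} = Θ_{j,i} + δ and Θ'_{j+m_i,i} = Θ_{j+m_i,i} − δ. (In other words, the parameters of the RX gates on qubit i in layers j and j + m_i can be combined: the circuit unitary depends on them only through their sum.) -/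
open Matrix

noncomputable section

/-- The `n`-qubit `L`-layer RX-CX ansatz with linear entanglement,
`U(Θ) = Lay_{n-1}(Θ_{L-1}) · ⋯ · Lay_{n-1}(Θ_0)`. -/
def ansatz (n L : ℕ) (Θ : Fin L → Fin n → ℝ) : Matrix (Fin n → Fin 2) (Fin n → Fin 2) ℂ :=
  ((List.finRange L).reverse.map (fun t => LayU n (Θ t))).prod

/-- The tensor product of `X` gates on the qubits `q` with `w q = 1`. -/
def xString {n : ℕ} (w : Fin n → Fin 2) : Matrix (Fin n → Fin 2) (Fin n → Fin 2) ℂ :=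
  fun u v => if u = v + w then 1 else 0

/-- The rotation by the angle `δ` generated by the `X`-string `w`. -/
def xRot {n : ℕ} (w : Fin n → Fin 2) (δ : ℝ) : Matrix (Fin n → Fin 2) (Fin n → Fin 2) ℂ :=
  (Real.cos (δ / 2) : ℂ) • 1 + (-Complex.I * (Real.sin (δ / 2) : ℂ)) • xString w

theorem fin_two_add_add_cancel (a b : Fin 2) : a + b + b = a := by
  revert a b; decide

theorem eq_add_iff_add_eq {n : ℕ} (u v w : Fin n → Fin 2) : u = v + w ↔ v = u + w := by
  constructor <;> rintro rfl <;> funext q <;> simp [fin_two_add_add_cancel]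

theorem mul_xString_apply {n : ℕ} (A : Matrix (Fin n → Fin 2) (Fin n → Fin 2) ℂ)
    (w u v : Fin n → Fin 2) : (A * xString w) u v = A u (v + w) := by
  simp [Matrix.mul_apply, xString]

theorem xString_mul_apply {n : ℕ} (A : Matrix (Fin n → Fin 2) (Fin n → Fin 2) ℂ)
    (w u v : Fin n → Fin 2) : (xString w * A) u v = A (u + w) v := by
  simp [Matrix.mul_apply, xString, eq_add_iff_add_eq u]

theorem mul_xRot_eq_xRot_mul {n : ℕ} {A : Matrix (Fin n → Fin 2) (Fin n → Fin 2) ℂ}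
    {w w' : Fin n → Fin 2} (h : A * xString w = xString w' * A) (δ : ℝ) :
    A * xRot w δ = xRot w' δ * A := by
  simp only [xRot, mul_add, add_mul, Matrix.mul_smul, Matrix.smul_mul, mul_one, one_mul, h]

theorem CXe_mul_xString {n : ℕ} {c t : Fin n} (hct : c ≠ t) (w : Fin n → Fin 2) :
    CXe c t * xString w = xString (Function.update w t (w t + w c)) * CXe c t := by
  ext u v
  rw [mul_xString_apply, xString_mul_apply]
  have h : Function.update (v + w) t ((v + w) t + (v + w) c)
      = Function.update v t (v t + v c) + Function.update w t (w t + w c) := by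
    funext q
    by_cases hq : q = t
    · subst hq
      simp only [Function.update_self, Pi.add_apply]
      abel
    · simp [Function.update_of_ne hq]
  simp only [CXe, h]
  refine if_congr ?_ rfl rfl
  rw [eq_add_iff_add_eq, eq_comm]

theorem RXg_add_right (θ : ℝ) (a b c : Fin 2) : RXg θ a (b + c) = RXg θ (a + c) b := by
  fin_cases a <;> fin_cases b <;> fin_cases c <;> simp [RXg]

theorem RXall_mul_xString {n : ℕ} (θ : Fin n → ℝ) (w : Fin n → Fin 2) :
    RXall θ * xString w = xString w * RXall θ := by
  ext u v
  rw [mul_xString_apply, xString_mul_apply]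
  simp [RXall, RXg_add_right]

theorem RXg_add (θ δ : ℝ) (a b : Fin 2) :
    RXg (θ + δ) a b = (Real.cos (δ / 2) : ℂ) * RXg θ a b
      + (-Complex.I * (Real.sin (δ / 2) : ℂ)) * RXg θ a (b + 1) := by
  have hI := Complex.I_mul_I
  fin_cases a <;> fin_cases b <;>
    simp [RXg, add_div, Complex.cos_add, Complex.sin_add] <;>
    first
    | ring1
    | linear_combination (-Complex.sin (θ / 2) * Complex.sin (δ / 2)) * hI

/-- Increasing one angle of a rotation layer by `δ` multiplies the layer by a rotation. -/
theorem RXall_mul_xRot_single {n : ℕ} (θ : Fin n → ℝ) (i : Fin n) (δ : ℝ) :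
    RXall θ * xRot (Pi.single i 1) δ = RXall (Function.update θ i (θ i + δ)) := by
  ext u v
  have key : ∀ (φ : Fin n → ℝ) (x : Fin n → Fin 2),
      (∀ q, q ≠ i → φ q = θ q) → (∀ q, q ≠ i → x q = v q) →
      RXall φ u x = RXg (φ i) (u i) (x i) *
        ∏ q ∈ Finset.univ.erase i, RXg (θ q) (u q) (v q) := by
    intro φ x hφ hx
    rw [RXall, ← Finset.mul_prod_erase _ _ (Finset.mem_univ i)]
    congr 1
    refine Finset.prod_congr rfl fun q hq => ?_
    rw [hφ q (Finset.ne_of_mem_erase hq), hx q (Finset.ne_of_mem_erase hq)]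
  simp only [xRot, mul_add, Matrix.mul_smul, mul_one, Matrix.add_apply, Matrix.smul_apply,
    mul_xString_apply, smul_eq_mul]
  rw [key θ v (fun _ _ => rfl) (fun _ _ => rfl),
    key θ (v + Pi.single i 1) (fun _ _ => rfl) (fun q hq => by simp [hq]),
    key (Function.update θ i (θ i + δ)) v (fun q hq => by simp [hq]) (fun _ _ => rfl)]
  simp only [Function.update_self, Pi.add_apply, Pi.single_eq_same, RXg_add]
  ring

/-- Adds to each of the first `m` bits of `w` the following bit. -/
def bitDiff {n : ℕ} (m : ℕ) (w : Fin n → Fin 2) : Fin n → Fin 2 :=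
  fun q => w q + if h : q.val < m ∧ q.val + 1 < n then w ⟨q.val + 1, h.2⟩ else 0

theorem prod_CXe_mul_xString {n : ℕ} (m : ℕ) (hm : m ≤ n - 1) (w : Fin n → Fin 2) :
    ((List.finRange m).map (fun j => CXe (n := n)
        ⟨j.val + 1, by have := j.isLt; omega⟩ ⟨j.val, by have := j.isLt; omega⟩)).prod
        * xString (bitDiff m w)
      = xString w * ((List.finRange m).map (fun j => CXe (n := n)
        ⟨j.val + 1, by have := j.isLt; omega⟩ ⟨j.val, by have := j.isLt; omega⟩)).prod := by
  induction m with
  | zero =>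
    have h : bitDiff 0 w = w := by funext q; simp [bitDiff]
    simp [h]
  | succ m ih =>
    rw [List.finRange_succ_last]
    simp only [List.map_append, List.map_map, List.map_cons, List.map_nil, List.prod_append,
      List.prod_singleton, Function.comp_def, Fin.val_castSucc, Fin.val_last]
    rw [mul_assoc, CXe_mul_xString (by simp [Fin.ext_iff]), ← mul_assoc, ← mul_assoc,
      ← ih (by omega)]
    congr 3
    funext q
    by_cases hq : q.val = m
    · obtain ⟨q, hqn⟩ := q
      simp only at hq
      subst hq
      have h : q + 1 < n := by omega
      simp [bitDiff, h, fin_two_add_add_cancel]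
    · rw [Function.update_of_ne (by simpa [Fin.ext_iff] using hq)]
      have h : q.val < m + 1 ↔ q.val < m := by omega
      simp [bitDiff, h]

theorem LayU_mul_xRot {n : ℕ} (θ : Fin n → ℝ) (w : Fin n → Fin 2) (δ : ℝ) :
    LayU n θ * xRot (bitDiff (n - 1) w) δ = xRot w δ * LayU n θ := by
  refine mul_xRot_eq_xRot_mul ?_ δ
  have h : Elin n * xString (bitDiff (n - 1) w) = xString w * Elin n :=
    prod_CXe_mul_xString (n - 1) le_rfl w
  rw [LayU, mul_assoc, RXall_mul_xString, ← mul_assoc, h, mul_assoc]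

theorem LayU_mul_xRot_single {n : ℕ} (θ : Fin n → ℝ) (i : Fin n) (δ : ℝ) :
    LayU n θ * xRot (Pi.single i 1) δ = LayU n (Function.update θ i (θ i + δ)) := by
  rw [LayU, mul_assoc, RXall_mul_xRot_single, LayU]

/-- In characteristic two, `(1 + N) ^ 2 ^ k = 1 + N ^ 2 ^ k` for the shift `N`. -/
theorem bitDiff_iterate_two_pow {n : ℕ} (k : ℕ) (w : Fin n → Fin 2) (q : Fin n) :
    (bitDiff (n - 1))^[2 ^ k] w q
      = w q + if h : q.val + 2 ^ k < n then w ⟨q.val + 2 ^ k, h⟩ else 0 := by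
  induction k generalizing w q with
  | zero =>
    have h : (q.val < n - 1 ∧ q.val + 1 < n) ↔ q.val + 1 < n := by omega
    simp [bitDiff, h]
  | succ k ih =>
    have hk : 2 ^ (k + 1) = 2 ^ k + 2 ^ k := by ring
    simp only [hk, Function.iterate_add_apply, ih, ← add_assoc]
    by_cases h₁ : q.val + 2 ^ k < n
    · simp only [h₁, dif_pos, ← add_assoc, fin_two_add_add_cancel]
    · have h₂ : ¬ q.val + 2 ^ k + 2 ^ k < n := by omega
      simp [h₁, h₂]

theorem bitDiff_iterate_single {n : ℕ} (i : Fin n) :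
    (bitDiff (n - 1))^[2 ^ Nat.clog 2 (i.val + 1)] (Pi.single i 1) = Pi.single i 1 := by
  funext q
  have hi := Nat.le_pow_clog one_lt_two (i.val + 1)
  rw [bitDiff_iterate_two_pow]
  split_ifs with h
  · rw [Pi.single_eq_of_ne (i := i) (i' := ⟨_, h⟩) (by simp [Fin.ext_iff]; omega), add_zero]
  · rw [add_zero]

theorem ansatz_succ (n L : ℕ) (Θ : Fin (L + 1) → Fin n → ℝ) :
    ansatz n (L + 1) Θ
      = LayU n (Θ (Fin.last L)) * ansatz n L (fun t => Θ t.castSucc) := by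
  simp [ansatz, List.finRange_succ_last, Function.comp_def]

/-- A layer shift by `δ` at `j`, undone at `j + m`, propagates in between as an `X`-rotation. -/
theorem ansatz_shift (n L : ℕ) (Θ : Fin L → Fin n → ℝ) (i : Fin n) (j m : ℕ) (hm : 0 < m)
    (hi : (bitDiff (n - 1))^[m] (Pi.single i 1) = Pi.single i 1) (δ : ℝ) :
    ansatz n L (fun t q =>
        if t.val = j ∧ q = i then Θ t q + δ
        else if t.val = j + m ∧ q = i then Θ t q - δ
        else Θ t q)
      = if j < L ∧ L ≤ j + m then
          xRot ((bitDiff (n - 1))^[j + m - L] (Pi.single i 1)) δ * ansatz n L Θ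
        else ansatz n L Θ := by
  induction L with
  | zero => simp [ansatz]
  | succ L ih =>
    have step : ∀ (θ : Fin n → ℝ) (p : ℕ), LayU n θ *
        xRot ((bitDiff (n - 1))^[p + 1] (Pi.single i 1)) δ
        = xRot ((bitDiff (n - 1))^[p] (Pi.single i 1)) δ * LayU n θ := fun θ p => by
      rw [Function.iterate_succ_apply', LayU_mul_xRot]
    rw [ansatz_succ, ansatz_succ n L Θ]
    simp only [Fin.val_castSucc, Fin.val_last]
    rw [ih (fun t => Θ t.castSucc)]
    set A := ansatz n L (fun t => Θ t.castSucc)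
    set θ := Θ (Fin.last L)
    rcases lt_trichotomy L j with h | rfl | h
    · simp [show ¬ j < L by omega, show ¬ j < L + 1 by omega, show L ≠ j by omega,
        show L ≠ j + m by omega]
    · obtain ⟨p, rfl⟩ : ∃ p, m = p + 1 := ⟨m - 1, by omega⟩
      have hθ : (fun q => if L = L ∧ q = i then θ q + δ
          else if L = L + (p + 1) ∧ q = i then θ q - δ else θ q)
          = Function.update θ i (θ i + δ) := by
        funext q
        by_cases hq : q = i
        · subst hq; simp
        · simp [hq]
      have hs := step θ p
      rw [hi, LayU_mul_xRot_single] at hs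
      rw [hθ, if_neg (by omega), if_pos (by omega), hs, mul_assoc,
        show L + (p + 1) - (L + 1) = p by omega]
    · rcases lt_trichotomy L (j + m) with h' | h' | h'
      · obtain ⟨p, hp⟩ : ∃ p, j + m - L = p + 1 := ⟨j + m - L - 1, by omega⟩
        simp only [show L ≠ j by omega, show L ≠ j + m by omega, false_and, if_false]
        rw [if_pos (by omega), if_pos (by omega), hp, ← mul_assoc, step, mul_assoc,
          show j + m - (L + 1) = p by omega]
      · have hθ : (fun q => if L = j ∧ q = i then θ q + δ
            else if L = j + m ∧ q = i then θ q - δ else θ q)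
            = Function.update θ i (θ i - δ) := by
          funext q
          by_cases hq : q = i
          · subst hq; simp [h', hm.ne']
          · simp [hq]
        rw [hθ, if_pos (by omega), if_neg (by omega), show j + m - L = 0 by omega,
          Function.iterate_zero_apply, ← mul_assoc, LayU_mul_xRot_single]
        simp
      · simp [show L ≠ j by omega, show L ≠ j + m by omega, show ¬ L ≤ j + m by omega,
          show ¬ L + 1 ≤ j + m by omega]

theorem stmt7 (n L : ℕ) (hn : 1 ≤ n) (hL : 1 ≤ L)
    (Θ : Fin L → Fin n → ℝ) (i : Fin n) (j : ℕ)
    (hj : j + 2 ^ Nat.clog 2 (i.val + 1) ≤ L - 1) (δ : ℝ) :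
    ansatz n L (fun t q =>
        if t.val = j ∧ q = i then Θ t q + δ
        else if t.val = j + 2 ^ Nat.clog 2 (i.val + 1) ∧ q = i then Θ t q - δ
        else Θ t q)
      = ansatz n L Θ := by
  rw [ansatz_shift n L Θ i j _ (by positivity) (bitDiff_iterate_single i) δ,
    if_neg (by omega)]

end
end

section
/- Let n ≥ 1, L ≥ 1, and let U(Θ) := Lay_{n−1}(Θ_{L−1}) · ⋯ · Lay_{n−1}(Θ_0) be the n-qubit L-layer RX-CX ansatz with linear entanglement. For every Θ ∈ (ℝ^n)^L there exists Θ' ∈ (ℝ^n)^L with Θ'_{j,i} = 0 whenever j ≥ 2^{⌈log₂(i+1)⌉}, such that U(Θ') = U(Θ). In particular, every unitary realizable by the ansatz (for any number of layers) is realizable with at most 2^{⌈log₂(i+1)⌉} nonzero parameters on qubit i, for each i. -/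
open Matrix

noncomputable section

section

variable {n : ℕ}

/-- The matrix translating the basis states by the vector `w`. -/
def translationMatrix (w : Fin n → Fin 2) : Matrix (Fin n → Fin 2) (Fin n → Fin 2) ℂ :=
  fun u v => if u = w + v then 1 else 0

lemma translationMatrix_zero : translationMatrix (0 : Fin n → Fin 2) = 1 := by
  ext u v
  simp [translationMatrix, Matrix.one_apply]

lemma translationMatrix_add (w w' : Fin n → Fin 2) :
    translationMatrix (w + w') = translationMatrix w * translationMatrix w' := by
  ext u v
  simp [translationMatrix, Matrix.mul_apply, add_assoc]

/-- The translation matrices as a multiplicative representation. -/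
def translationHom (n : ℕ) :
    Multiplicative (Fin n → Fin 2) →* Matrix (Fin n → Fin 2) (Fin n → Fin 2) ℂ where
  toFun w := translationMatrix w.toAdd
  map_one' := translationMatrix_zero
  map_mul' w w' := translationMatrix_add w.toAdd w'.toAdd

/-- The group algebra of the bit strings acting on the state space by translations. -/
def translationRep (n : ℕ) :
    AddMonoidAlgebra ℂ (Fin n → Fin 2) →ₐ[ℂ] Matrix (Fin n → Fin 2) (Fin n → Fin 2) ℂ :=
  AddMonoidAlgebra.lift ℂ _ _ (translationHom n)

lemma translationRep_single (w : Fin n → Fin 2) (c : ℂ) :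
    translationRep n (AddMonoidAlgebra.single w c) = c • translationMatrix w :=
  AddMonoidAlgebra.lift_single _ _ _

lemma bits_add_self (w : Fin n → Fin 2) : w + w = 0 := by
  funext i
  exact (by decide : ∀ a : Fin 2, a + a = 0) (w i)

/-- The rotation of angle `θ` generated by the translation by `w`, in the group algebra. -/
def rot (θ : ℝ) (w : Fin n → Fin 2) : AddMonoidAlgebra ℂ (Fin n → Fin 2) :=
  AddMonoidAlgebra.single 0 (Real.cos (θ / 2) : ℂ) +
    AddMonoidAlgebra.single w (-Complex.I * (Real.sin (θ / 2) : ℂ))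

lemma rot_zero (w : Fin n → Fin 2) : rot 0 w = 1 := by
  simp [rot, AddMonoidAlgebra.one_def]

lemma rot_add (θ φ : ℝ) (w : Fin n → Fin 2) : rot (θ + φ) w = rot θ w * rot φ w := by
  simp only [rot, add_mul, mul_add, AddMonoidAlgebra.single_mul_single, zero_add, add_zero,
    bits_add_self, add_div, Real.cos_add, Real.sin_add]
  have regroup (a b c d : AddMonoidAlgebra ℂ (Fin n → Fin 2)) :
      a + b + (c + d) = (a + d) + (b + c) := by abel
  rw [regroup, ← AddMonoidAlgebra.single_add, ← AddMonoidAlgebra.single_add]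
  congr 2
  · push_cast
    linear_combination (-Complex.sin (θ / 2) * Complex.sin (φ / 2)) * Complex.I_sq
  · push_cast
    ring

lemma rot_sum {ι : Type*} (s : Finset ι) (θ : ι → ℝ) (w : Fin n → Fin 2) :
    rot (∑ i ∈ s, θ i) w = ∏ i ∈ s, rot (θ i) w := by
  classical
  induction s using Finset.induction_on with
  | empty => simp [rot_zero]
  | insert a s ha ih => rw [Finset.sum_insert ha, Finset.prod_insert ha, rot_add, ih]

lemma RXg_apply (θ : ℝ) (a b : Fin 2) : RXg θ a b = RXg θ (a - b) 0 := by
  fin_cases a <;> fin_cases b <;> simp [RXg]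

lemma RXall_eq_translationRep (θ : Fin n → ℝ) :
    RXall θ = translationRep n (∏ i, rot (θ i) (Pi.single i 1)) := by
  have hrot (i : Fin n) : rot (θ i) (Pi.single i 1) =
      ∑ b : Fin 2, AddMonoidAlgebra.single (Pi.single i b : Fin n → Fin 2) (RXg (θ i) b 0) := by
    simp [rot, RXg]
  simp_rw [hrot, Fintype.prod_sum, AddMonoidAlgebra.prod_single, Finset.univ_sum_single, map_sum,
    translationRep_single]
  ext u v
  simp only [Matrix.sum_apply, Matrix.smul_apply, translationMatrix, smul_eq_mul, mul_ite, mul_one,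
    mul_zero]
  simp_rw [← sub_eq_iff_eq_add]
  simp [RXall, fun i => RXg_apply (θ i) (u i) (v i)]

/-- The bit string `v` extended by zeros. -/
def extendBits (v : Fin n → Fin 2) (k : ℕ) : Fin 2 :=
  if h : k < n then v ⟨k, h⟩ else 0

/-- The linear map on bit strings inverse to the one implemented by `Elin n`. -/
def shiftAdd (n : ℕ) : (Fin n → Fin 2) →+ (Fin n → Fin 2) where
  toFun v i := v i + extendBits v (i + 1)
  map_zero' := by
    funext i
    simp [extendBits]
  map_add' v w := by
    funext i
    simp only [extendBits, Pi.add_apply]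
    split_ifs
    · exact add_add_add_comm _ _ _ _
    · simp

lemma shiftAdd_iterate_two_pow (m : ℕ) (v : Fin n → Fin 2) (i : Fin n) :
    (shiftAdd n)^[2 ^ m] v i = v i + extendBits v (i + 2 ^ m) := by
  induction m generalizing v i with
  | zero => rfl
  | succ m ih =>
    rw [pow_succ, mul_two, Function.iterate_add_apply, ih, ih, ← add_assoc]
    have hext : extendBits ((shiftAdd n)^[2 ^ m] v) (i + 2 ^ m) =
        extendBits v (i + 2 ^ m) + extendBits v (i + 2 ^ m + 2 ^ m) := by
      by_cases h : (i : ℕ) + 2 ^ m < n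
      · conv_lhs => rw [extendBits, dif_pos h, ih]
        conv_rhs => rw [extendBits, dif_pos h]
      · have h' : ¬ (i : ℕ) + 2 ^ m + 2 ^ m < n := by omega
        simp [extendBits, h, h']
    rw [hext]
    generalize v i = a
    generalize extendBits v (i + 2 ^ m) = b
    generalize extendBits v (i + 2 ^ m + 2 ^ m) = c
    revert a b c
    decide

lemma shiftAdd_iterate_single {m : ℕ} {i : Fin n} (h : (i : ℕ) < 2 ^ m) :
    (shiftAdd n)^[2 ^ m] (Pi.single i 1) = Pi.single i 1 := by
  funext k
  rw [shiftAdd_iterate_two_pow, add_eq_left, extendBits]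
  split_ifs
  · refine Pi.single_eq_of_ne ?_ _
    rw [ne_eq, Fin.ext_iff]
    simp only
    omega
  · rfl

/-- The matrix of a map of basis states. -/
def mapMatrix (f : (Fin n → Fin 2) → (Fin n → Fin 2)) :
    Matrix (Fin n → Fin 2) (Fin n → Fin 2) ℂ :=
  fun u v => if u = f v then 1 else 0

lemma mapMatrix_mul (f g : (Fin n → Fin 2) → (Fin n → Fin 2)) :
    mapMatrix f * mapMatrix g = mapMatrix (f ∘ g) := by
  ext u v
  simp [mapMatrix, Matrix.mul_apply]

lemma mapMatrix_id : mapMatrix (id : (Fin n → Fin 2) → (Fin n → Fin 2)) = 1 := by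
  ext u v
  simp [mapMatrix, Matrix.one_apply]

lemma CXe_eq_mapMatrix (c t : Fin n) :
    CXe c t = mapMatrix fun v => Function.update v t (v t + v c) := rfl

lemma CXe_mul_self {c t : Fin n} (h : c ≠ t) : CXe c t * CXe c t = 1 := by
  rw [CXe_eq_mapMatrix, mapMatrix_mul, ← mapMatrix_id]
  congr 1
  funext v
  have hbit (a b : Fin 2) : a + b + b = a := by
    revert a b
    decide
  simp [Function.update_of_ne h, hbit]

/-- The first `k` gates of the entanglement layer are inverted by `shiftAdd` on qubits `< k`. -/
lemma CXe_prod_mul_mapMatrix (k : ℕ) (hk : k ≤ n - 1) :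
    ((List.finRange k).map fun j : Fin k =>
        CXe (n := n) ⟨j + 1, by have := j.isLt; omega⟩ ⟨j, by have := j.isLt; omega⟩).prod *
      mapMatrix (fun v i => if (i : ℕ) < k then shiftAdd n v i else v i) = 1 := by
  induction k with
  | zero =>
    simp only [List.finRange_zero, List.map_nil, List.prod_nil, one_mul, not_lt_zero, if_false]
    exact mapMatrix_id
  | succ k ih =>
    have hk0 : k < n := by omega
    have hk1 : k + 1 < n := by omega
    have hstep : mapMatrix (fun v i => if (i : ℕ) < k + 1 then shiftAdd n v i else v i) =
        CXe ⟨k + 1, hk1⟩ ⟨k, hk0⟩ *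
          mapMatrix (fun v i => if (i : ℕ) < k then shiftAdd n v i else v i) := by
      rw [CXe_eq_mapMatrix, mapMatrix_mul]
      congr 1
      funext v i
      rcases eq_or_ne i ⟨k, hk0⟩ with rfl | hi
      · simp [shiftAdd, extendBits, hk1]
      · have hi' : (i : ℕ) ≠ k := fun h => hi (Fin.ext h)
        have hlt : (i : ℕ) < k + 1 ↔ (i : ℕ) < k := by omega
        simp [Function.update_of_ne hi, hlt]
    rw [hstep, List.finRange_succ_last, List.map_append, List.prod_append, List.map_map]
    simp only [List.map_cons, List.map_nil, List.prod_singleton, Fin.val_last]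
    rw [mul_assoc, ← mul_assoc (CXe _ _) (CXe _ _),
      CXe_mul_self (by simp [Fin.ext_iff]), one_mul]
    exact ih (by omega)

lemma Elin_mul_mapMatrix_shiftAdd : Elin n * mapMatrix (shiftAdd n) = 1 := by
  rw [← CXe_prod_mul_mapMatrix (n - 1) le_rfl, Elin]
  congr 2
  funext v i
  split_ifs with h
  · rfl
  · have hi : ¬ (i : ℕ) + 1 < n := by omega
    simp [shiftAdd, extendBits, hi]

lemma translationMatrix_mul_Elin (w : Fin n → Fin 2) :
    translationMatrix w * Elin n = Elin n * translationMatrix (shiftAdd n w) := by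
  have hcomm : mapMatrix (shiftAdd n) * translationMatrix w =
      translationMatrix (shiftAdd n w) * mapMatrix (shiftAdd n) := by
    change mapMatrix (shiftAdd n) * mapMatrix (fun v => w + v) =
      mapMatrix (fun v => shiftAdd n w + v) * mapMatrix (shiftAdd n)
    rw [mapMatrix_mul, mapMatrix_mul]
    congr 1
    funext v
    simp
  have hinv := Elin_mul_mapMatrix_shiftAdd (n := n)
  calc translationMatrix w * Elin n
      = Elin n * (mapMatrix (shiftAdd n) * translationMatrix w) * Elin n := by
        rw [← mul_assoc, hinv, one_mul]
    _ = Elin n * translationMatrix (shiftAdd n w) * (mapMatrix (shiftAdd n) * Elin n) := by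
        rw [hcomm]
        simp only [mul_assoc]
    _ = Elin n * translationMatrix (shiftAdd n w) := by
        rw [mul_eq_one_comm.mp hinv, mul_one]

lemma translationRep_rot_mul_Elin (θ : ℝ) (w : Fin n → Fin 2) :
    translationRep n (rot θ w) * Elin n = Elin n * translationRep n (rot θ (shiftAdd n w)) := by
  simp only [rot, map_add, translationRep_single, add_mul, mul_add, smul_mul_assoc,
    mul_smul_comm, translationMatrix_mul_Elin, map_zero]

lemma translationRep_prod_rot_mul_Elin {ι : Type*} (s : Finset ι) (θ : ι → ℝ)
    (w : ι → Fin n → Fin 2) :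
    translationRep n (∏ i ∈ s, rot (θ i) (w i)) * Elin n =
      Elin n * translationRep n (∏ i ∈ s, rot (θ i) (shiftAdd n (w i))) := by
  classical
  induction s using Finset.induction_on with
  | empty => simp
  | insert a s ha ih =>
    rw [Finset.prod_insert ha, Finset.prod_insert ha, map_mul, map_mul, mul_assoc, ih,
      ← mul_assoc, translationRep_rot_mul_Elin, mul_assoc]

lemma translationRep_prod_rot_mul_Elin_pow {ι : Type*} (s : Finset ι) (θ : ι → ℝ)
    (w : ι → Fin n → Fin 2) (j : ℕ) :
    translationRep n (∏ i ∈ s, rot (θ i) (w i)) * Elin n ^ j =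
      Elin n ^ j * translationRep n (∏ i ∈ s, rot (θ i) ((shiftAdd n)^[j] (w i))) := by
  induction j with
  | zero => simp
  | succ j ih =>
    simp only [Function.iterate_succ_apply']
    rw [pow_succ, ← mul_assoc, ih, mul_assoc, translationRep_prod_rot_mul_Elin, mul_assoc]

/-- The ansatz with all entanglement layers moved to the left. -/
lemma ansatz_eq (L : ℕ) (Θ : Fin L → Fin n → ℝ) :
    ansatz n L Θ = Elin n ^ L *
      translationRep n (∏ j : Fin L, ∏ i, rot (Θ j i) ((shiftAdd n)^[j] (Pi.single i 1))) := by
  induction L with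
  | zero => simp [ansatz]
  | succ L ih =>
    have hsucc : ansatz n (L + 1) Θ =
        LayU n (Θ (Fin.last L)) * ansatz n L fun j => Θ j.castSucc := by
      simp [ansatz, List.finRange_succ_last, Function.comp_def, ← List.map_reverse]
    rw [hsucc, ih, LayU, RXall_eq_translationRep, mul_assoc, ← mul_assoc (translationRep n _),
      translationRep_prod_rot_mul_Elin_pow, mul_assoc, ← map_mul, ← mul_assoc, ← pow_succ',
      Fin.prod_univ_castSucc, mul_comm (∏ i, _)]
    rfl

end

theorem stmt8 (n L : ℕ) (hn : 1 ≤ n) (hL : 1 ≤ L) (Θ : Fin L → Fin n → ℝ) :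
    ∃ Θ' : Fin L → Fin n → ℝ,
      (∀ (j : Fin L) (i : Fin n), 2 ^ Nat.clog 2 (i.val + 1) ≤ j.val → Θ' j i = 0) ∧
      ansatz n L Θ' = ansatz n L Θ := by
  let p (i : Fin n) : ℕ := 2 ^ Nat.clog 2 (i.val + 1)
  let fold (i : Fin n) (j : Fin L) : Fin L := ⟨j % p i, (Nat.mod_le _ _).trans_lt j.isLt⟩
  refine ⟨fun j i => ∑ j' with fold i j' = j, Θ j' i, fun j i hj => ?_, ?_⟩
  · refine Finset.sum_eq_zero fun j' hj' => ?_
    rw [Finset.mem_filter] at hj'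
    have hlt : (j' : ℕ) % p i < p i := Nat.mod_lt _ (by positivity)
    have heq : (j' : ℕ) % p i = j := congrArg Fin.val hj'.2
    exact absurd hj (not_le.mpr (heq ▸ hlt))
  · rw [ansatz_eq, ansatz_eq, Finset.prod_comm]
    conv_rhs => rw [Finset.prod_comm]
    congr 2
    refine Finset.prod_congr rfl fun i _ => ?_
    conv_rhs => rw [← Finset.prod_fiberwise Finset.univ (fold i)]
    refine Finset.prod_congr rfl fun j _ => ?_
    rw [rot_sum]
    refine Finset.prod_congr rfl fun j' hj' => ?_
    rw [Finset.mem_filter] at hj'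
    have hper : Function.IsPeriodicPt (shiftAdd n) (p i) (Pi.single i 1) :=
      shiftAdd_iterate_single (Nat.le_pow_clog one_lt_two _)
    rw [← hj'.2, ← hper.iterate_mod_apply j']

end
end

section
/- For every natural number n ≥ 1, the sum ∑_{i=1}^{n} 2^{⌈log₂ i⌉} is at most ⌊(3n² + 1)/4⌋; equivalently, 4 · ∑_{i=1}^{n} 2^{Nat.clog 2 i} ≤ 3n² + 1. -/
theorem Nat.clog_two_succ_of_lt_pow {n : ℕ} (h : n < 2 ^ Nat.clog 2 n) :
    Nat.clog 2 (n + 1) = Nat.clog 2 n :=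
  le_antisymm (Nat.clog_le_of_le_pow h) (Nat.clog_mono_right 2 n.le_succ)

theorem Nat.clog_two_two_pow_add_one (k : ℕ) : Nat.clog 2 (2 ^ k + 1) = k + 1 := by
  refine le_antisymm (Nat.clog_le_of_le_pow ?_) ?_
  · have := Nat.one_le_two_pow (n := k)
    rw [pow_succ]
    omega
  · exact (Nat.lt_clog_iff_pow_lt one_lt_two).2 (Nat.lt_succ_self _)

theorem three_mul_sum_two_pow_clog_add_sq (n : ℕ) (hn : 1 ≤ n) :
    3 * ∑ i ∈ Finset.Icc 1 n, 2 ^ Nat.clog 2 i + (2 ^ Nat.clog 2 n) ^ 2 =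
      3 * n * 2 ^ Nat.clog 2 n + 1 := by
  induction n, hn using Nat.le_induction with
  | base => simp
  | succ n hn ih =>
    rw [Finset.sum_Icc_succ_top (by omega)]
    rcases (Nat.le_pow_clog one_lt_two n).lt_or_eq with h | h
    · rw [Nat.clog_two_succ_of_lt_pow h]
      linarith
    · have hc : Nat.clog 2 (n + 1) = Nat.clog 2 n + 1 := by
        conv_lhs => rw [h]
        exact Nat.clog_two_two_pow_add_one _
      rw [hc, pow_succ, ← h]
      rw [← h] at ih
      linarith

theorem stmt9 (n : ℕ) (hn : 1 ≤ n) :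
    4 * ∑ i ∈ Finset.Icc 1 n, 2 ^ Nat.clog 2 i ≤ 3 * n ^ 2 + 1 := by
  have key := three_mul_sum_two_pow_clog_add_sq n hn
  have hdvd : ¬ 3 ∣ 2 ^ Nat.clog 2 n := fun h =>
    absurd (Nat.prime_three.dvd_of_dvd_pow h) (by norm_num)
  generalize 2 ^ Nat.clog 2 n = P at key hdvd
  generalize ∑ i ∈ Finset.Icc 1 n, 2 ^ Nat.clog 2 i = S at key ⊢
  have hne : (3 * n - 2 * P : ℤ) ≠ 0 := by omega
  have hsq : 0 < (3 * n - 2 * P : ℤ) ^ 2 := by positivity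
  zify at key ⊢
  linarith
end

section
/- Let r ≥ 1 and l = 2^{r+1}, and let a : Fin l → Bool be the alternating vector with a(i) = true if and only if i is even. Let p₁ be the prefix-XOR map and p₂ the suffix-XOR map on Fin l → Bool. Then for every composition f = f_1 ∘ f_2 ∘ ⋯ ∘ f_{l₁} with each f_s ∈ {p₁, p₂} and l₁ < l − 2, the number of indices i with f(a)(i) = true is even. -/
/-- The suffix-XOR map: `p₂(b)(i) = true` iff the number of indices `j ≥ i` with
`b j = true` is odd. -/
def sXor {N : ℕ} (b : Fin N → Bool) : Fin N → Bool :=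
  fun i => decide (Odd (Finset.univ.filter (fun j => i ≤ j ∧ b j = true)).card)

/-- The `N`-periodic extension of a Boolean vector to a `ZMod 2`-valued sequence. -/
def periodicExt {N : ℕ} [NeZero N] (b : Fin N → Bool) (m : ℕ) : ZMod 2 :=
  if b (Fin.ofNat N m) = true then 1 else 0

theorem periodicExt_mod {N : ℕ} [NeZero N] (b : Fin N → Bool) (m : ℕ) :
    periodicExt b (m % N) = periodicExt b m := by
  simp [periodicExt, Fin.ofNat]

theorem periodicExt_val {N : ℕ} [NeZero N] (b : Fin N → Bool) (i : Fin N) :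
    periodicExt b i.val = if b i = true then 1 else 0 := by
  simp [periodicExt]

theorem natCast_card_filter_eq_sum {N : ℕ} [NeZero N] (b : Fin N → Bool) (P : ℕ → Prop)
    [DecidablePred P] :
    (((Finset.univ.filter (fun j : Fin N => P j.val ∧ b j = true)).card : ℕ) : ZMod 2) =
      ∑ j ∈ Finset.range N, if P j then periodicExt b j else 0 := by
  rw [Finset.card_filter, Finset.sum_range]
  push_cast
  refine Finset.sum_congr rfl fun i _ => ?_
  rw [periodicExt_val]
  by_cases h : P i.val <;> simp [h]

theorem natCast_card_eq_sum {N : ℕ} [NeZero N] (b : Fin N → Bool) :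
    (((Finset.univ.filter (fun j : Fin N => b j = true)).card : ℕ) : ZMod 2) =
      ∑ j ∈ Finset.range N, periodicExt b j := by
  simpa using natCast_card_filter_eq_sum b (fun _ => True)

theorem ite_odd_eq_natCast (n : ℕ) : (if Odd n then 1 else 0 : ZMod 2) = n := by
  split_ifs with h
  · exact ((ZMod.natCast_eq_one_iff_odd).2 h).symm
  · exact ((ZMod.natCast_eq_zero_iff_even).2 (Nat.not_odd_iff_even.1 h)).symm

theorem periodicExt_pXor {N : ℕ} [NeZero N] (b : Fin N → Bool) (m : ℕ) :
    periodicExt (pXor b) m = ∑ j ∈ Finset.range (m % N + 1), periodicExt b j := by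
  have hm : m % N < N := Nat.mod_lt _ (NeZero.pos N)
  have h := natCast_card_filter_eq_sum b (fun j => j ≤ m % N)
  simp only [periodicExt, pXor, decide_eq_true_eq, ite_odd_eq_natCast, Fin.le_def,
    Fin.ofNat] at h ⊢
  rw [h, ← Finset.sum_filter]
  refine Finset.sum_congr ?_ fun _ _ => rfl
  ext j
  simp only [Finset.mem_filter, Finset.mem_range]
  omega

theorem periodicExt_sXor {N : ℕ} [NeZero N] (b : Fin N → Bool) (m : ℕ) :
    periodicExt (sXor b) m = ∑ j ∈ Finset.Ico (m % N) N, periodicExt b j := by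
  have h := natCast_card_filter_eq_sum b (fun j => m % N ≤ j)
  simp only [periodicExt, sXor, decide_eq_true_eq, ite_odd_eq_natCast, Fin.le_def,
    Fin.ofNat] at h ⊢
  rw [h, ← Finset.sum_filter]
  refine Finset.sum_congr ?_ fun _ _ => rfl
  ext j
  simp only [Finset.mem_filter, Finset.mem_range, Finset.mem_Ico]
  omega

theorem succ_mod_cases {N : ℕ} [NeZero N] (m : ℕ) :
    ((m + 1) % N = m % N + 1 ∧ m % N + 1 < N) ∨ ((m + 1) % N = 0 ∧ m % N + 1 = N) := by
  have hm : m % N < N := Nat.mod_lt _ (NeZero.pos N)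
  rcases Nat.lt_or_ge (m % N + 1) N with h | h
  · left
    refine ⟨?_, h⟩
    rw [← Nat.mod_add_mod, Nat.mod_eq_of_lt h]
  · right
    have h' : m % N + 1 = N := by omega
    refine ⟨?_, h'⟩
    rw [← Nat.mod_add_mod, h', Nat.mod_self]

theorem fwdDiff_periodicExt_pXor {N : ℕ} [NeZero N] (b : Fin N → Bool)
    (hb : ∑ j ∈ Finset.range N, periodicExt b j = 0) :
    fwdDiff 1 (periodicExt (pXor b)) = fun m => periodicExt b (m + 1) := by
  funext m
  simp only [fwdDiff, periodicExt_pXor]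
  rw [← periodicExt_mod b (m + 1)]
  rcases succ_mod_cases (N := N) m with ⟨h, h'⟩ | ⟨h, h'⟩
  · rw [h, Finset.sum_range_succ _ (m % N + 1)]
    ring
  · rw [h, h', hb]
    simp

theorem fwdDiff_periodicExt_sXor {N : ℕ} [NeZero N] (b : Fin N → Bool)
    (hb : ∑ j ∈ Finset.range N, periodicExt b j = 0) :
    fwdDiff 1 (periodicExt (sXor b)) = periodicExt b := by
  funext m
  have hm : m % N < N := Nat.mod_lt _ (NeZero.pos N)
  simp only [fwdDiff, periodicExt_sXor]
  rw [← periodicExt_mod b m, Finset.sum_eq_sum_Ico_succ_bot hm, CharTwo.sub_eq_add]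
  rcases succ_mod_cases (N := N) m with ⟨h, h'⟩ | ⟨h, h'⟩
  · rw [h, add_left_comm, CharTwo.add_self_eq_zero, add_zero]
  · rw [h, h', ← Finset.range_eq_Ico, hb]
    simp

theorem natCast_choose_two_pow_sub_one (k j : ℕ) (hj : j < 2 ^ k) :
    ((Nat.choose (2 ^ k - 1) j : ℕ) : ZMod 2) = 1 := by
  induction j with
  | zero => simp
  | succ j ih =>
    have h : 2 ^ k = 2 ^ k - 1 + 1 := by omega
    have h2 : ((Nat.choose (2 ^ k) (j + 1) : ℕ) : ZMod 2) = 0 :=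
      (ZMod.natCast_eq_zero_iff _ 2).2 (Nat.prime_two.dvd_choose_pow (by omega) (by omega))
    rw [h, Nat.choose_succ_succ, Nat.cast_add, ih (by omega)] at h2
    have h3 := CharTwo.add_eq_zero.1 h2
    exact h3.symm

theorem fwdDiff_iter_two_pow_sub_one (k : ℕ) (f : ℕ → ZMod 2) :
    (fwdDiff 1)^[2 ^ k - 1] f 0 = ∑ j ∈ Finset.range (2 ^ k), f j := by
  have h : 2 ^ k - 1 + 1 = 2 ^ k := Nat.sub_add_cancel Nat.one_le_two_pow
  rw [fwdDiff_iter_eq_sum_shift, h]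
  refine Finset.sum_congr rfl fun j hj => ?_
  have h1 : ((-1 : ℤ) : ZMod 2) = 1 := by decide
  rw [zsmul_eq_mul]
  push_cast
  rw [natCast_choose_two_pow_sub_one k j (Finset.mem_range.1 hj)]
  simp [CharTwo.neg_eq]

theorem fwdDiff_iter_zero (n : ℕ) : (fwdDiff 1)^[n] (0 : ℕ → ZMod 2) = 0 :=
  Function.iterate_fixed (by funext m; simp [fwdDiff]) n

theorem sum_periodicExt_eq_zero {k n : ℕ} (b : Fin (2 ^ k) → Bool) (hn : n ≤ 2 ^ k - 1)
    (h : (fwdDiff 1)^[n] (periodicExt b) = 0) :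
    ∑ j ∈ Finset.range (2 ^ k), periodicExt b j = 0 := by
  rw [← fwdDiff_iter_two_pow_sub_one, ← Nat.sub_add_cancel hn, Function.iterate_add_apply, h,
    fwdDiff_iter_zero]
  rfl

theorem fwdDiff_iter_comp_succ (n : ℕ) (f : ℕ → ZMod 2) :
    (fwdDiff 1)^[n] (fun m => f (m + 1)) = fun m => (fwdDiff 1)^[n] f (m + 1) := by
  induction n generalizing f with
  | zero => rfl
  | succ n ih => exact ih (fwdDiff 1 f)

theorem fwdDiff_iter_two_alternating (r : ℕ) :
    (fwdDiff 1)^[2] (periodicExt (fun i : Fin (2 ^ (r + 1)) => decide (Even i.val))) = 0 := by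
  have h : fwdDiff 1 (periodicExt (fun i : Fin (2 ^ (r + 1)) => decide (Even i.val))) =
      fun _ => 1 := by
    funext m
    have hE (n : ℕ) : Even (n % 2 ^ (r + 1)) ↔ Even n := by
      rw [Nat.even_iff, Nat.even_iff, Nat.mod_mod_of_dvd _ (dvd_pow_self 2 r.succ_ne_zero)]
    simp only [fwdDiff, periodicExt, Fin.ofNat, decide_eq_true_eq, hE, Nat.even_add_one]
    by_cases hm : Even m <;> simp [hm]
  rw [Function.iterate_succ_apply, h]
  funext m
  simp [fwdDiff]

theorem fwdDiff_iter_foldr_eq_zero {ι : Type*} (r : ℕ)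
    (g : ι → ((Fin (2 ^ (r + 1)) → Bool) → (Fin (2 ^ (r + 1)) → Bool)))
    (hg : ∀ s, g s = pXor ∨ g s = sXor) (L : List ι) (hL : L.length + 2 ≤ 2 ^ (r + 1)) :
    (fwdDiff 1)^[L.length + 2] (periodicExt (List.foldr (fun s acc => g s acc)
      (fun i : Fin (2 ^ (r + 1)) => decide (Even i.val)) L)) = 0 := by
  induction L with
  | nil => exact fwdDiff_iter_two_alternating r
  | cons s L ih =>
    rw [List.length_cons] at hL ⊢
    specialize ih (by omega)
    have hT := sum_periodicExt_eq_zero _ (by omega) ih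
    rw [List.foldr_cons, Nat.add_right_comm, Function.iterate_succ_apply]
    rcases hg s with h | h
    · rw [h, fwdDiff_periodicExt_pXor _ hT, fwdDiff_iter_comp_succ, ih]
      rfl
    · rw [h, fwdDiff_periodicExt_sXor _ hT, ih]

theorem stmt11 (r : ℕ) (hr : 1 ≤ r) (l₁ : ℕ) (hl₁ : l₁ < 2 ^ (r + 1) - 2)
    (g : Fin l₁ → ((Fin (2 ^ (r + 1)) → Bool) → (Fin (2 ^ (r + 1)) → Bool)))
    (hg : ∀ s, g s = pXor ∨ g s = sXor) :
    Even (Finset.univ.filter (fun i =>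
      (List.foldr (fun s acc => g s acc)
          (fun i : Fin (2 ^ (r + 1)) => decide (Even i.val))
          (List.finRange l₁)) i = true)).card := by
  have hlen : (List.finRange l₁).length = l₁ := List.length_finRange
  rw [← ZMod.natCast_eq_zero_iff_even, natCast_card_eq_sum]
  exact sum_periodicExt_eq_zero _ (by omega)
    (fwdDiff_iter_foldr_eq_zero r g hg (List.finRange l₁) (by omega))
end
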